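/- Asymptotic expansion of the smoothing operator: for every smooth vector a ∈ A^∞ and every N ∈ ℕ there is a constant C ≥ 0 such that for all ℏ ∈ (0, 1], ‖S_ℏ(a) − Σ_{j=0}^{N−1} (1/j!) (ℏ/4)^j Δ_g^j a‖ ≤ C ℏ^N; in particular S_ℏ(a) admits the asymptotic expansion e^{(ℏ/4) Δ_g} a as ℏ → 0⁺. -/

import Mathlib

open MeasureTheory Filter

/-- The standard symplectic form `θ` on `ℝ^{2n}`:
`θ(u,v) = Σ_{k=1}^n (u_k v_{n+k} - u_{n+k} v_k)`. -/
noncomputable def stdSymp (n : ℕ) (u v : Fin (2*n) → ℝ) : ℝ :=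
  ∑ k : Fin n,
    (u ⟨k.1, by omega⟩ * v ⟨n + k.1, by omega⟩ - u ⟨n + k.1, by omega⟩ * v ⟨k.1, by omega⟩)

/-- Rieffel's Gaussian smoothing operator
`S_ℏ(a) = (πℏ)^{-n} ∫_{ℝ^{2n}} e^{-g(u,u)/ℏ} α_u(a) du` (a Bochner integral w.r.t. Lebesgue
measure). -/
noncomputable def smoothingOp {n : ℕ} {A : Type*} [NonUnitalCStarAlgebra A]
    (α : (Fin (2*n) → ℝ) → (A ≃⋆ₐ[ℂ] A)) (g : (Fin (2*n) → ℝ) → (Fin (2*n) → ℝ) → ℝ)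
    (ℏ : ℝ) (a : A) : A :=
  ((Real.pi * ℏ) ^ n)⁻¹ • ∫ u : Fin (2*n) → ℝ, Real.exp (-(g u u) / ℏ) • α u a

/-- The `k`-th standard basis vector of `ℝ^{2n}`. -/
noncomputable def basisVec (n : ℕ) (k : Fin (2*n)) : Fin (2*n) → ℝ := Pi.single k 1

/-- The derivative `∂_k b = d/dt|_{t=0} α_{t e_k}(b)` of the action in the direction of the
`k`-th standard basis vector. -/
noncomputable def actDeriv {n : ℕ} {A : Type*} [NonUnitalCStarAlgebra A]
    (α : (Fin (2*n) → ℝ) → (A ≃⋆ₐ[ℂ] A)) (k : Fin (2*n)) (a : A) : A :=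
  deriv (fun t : ℝ => α (t • basisVec n k) a) 0

/-- The Laplacian `Δ_g a = Σ_{k,l} g^{kl} ∂_k ∂_l a` associated to `g` and the action, where
`(g^{kl})` is the inverse of the matrix `(g(e_k, e_l))`. -/
noncomputable def actLaplacian {n : ℕ} {A : Type*} [NonUnitalCStarAlgebra A]
    (α : (Fin (2*n) → ℝ) → (A ≃⋆ₐ[ℂ] A)) (g : (Fin (2*n) → ℝ) → (Fin (2*n) → ℝ) → ℝ)
    (a : A) : A :=
  ∑ k : Fin (2*n), ∑ l : Fin (2*n),
    ((Matrix.of fun i j => g (basisVec n i) (basisVec n j))⁻¹ k l) •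
      actDeriv α k (actDeriv α l a)

section Gaussian

variable {ι : Type*} [Fintype ι]

lemma integrable_exp_neg_sum_sq :
    Integrable (fun w : ι → ℝ => Real.exp (-∑ i, w i ^ 2)) := by
  have h := Integrable.fintype_prod (ι := ι) (μ := fun _ => (volume : Measure ℝ))
    (f := fun _ x => Real.exp (-1 * x ^ 2)) fun _ => integrable_exp_neg_mul_sq one_pos
  refine h.congr (Eventually.of_forall fun w => ?_)
  simp [← Real.exp_sum]

lemma integral_exp_neg_sum_sq :
    ∫ w : ι → ℝ, Real.exp (-∑ i, w i ^ 2) = √Real.pi ^ Fintype.card ι := by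
  have h := integral_fintype_prod_volume_eq_pow (ι := ι) (fun x : ℝ => Real.exp (-1 * x ^ 2))
  rw [integral_gaussian, div_one] at h
  rw [← h]
  exact integral_congr_ae (Eventually.of_forall fun w => by simp [← Real.exp_sum])

variable [DecidableEq ι]

lemma integrable_coord_mul_exp_neg_sum_sq (k : ι) :
    Integrable (fun w : ι → ℝ => w k * Real.exp (-∑ i, w i ^ 2)) := by
  have h := Integrable.fintype_prod (ι := ι) (μ := fun _ => (volume : Measure ℝ))
    (f := fun i x => (if i = k then x else 1) * Real.exp (-1 * x ^ 2)) fun i => by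
      by_cases hi : i = k
      · simpa [hi] using integrable_mul_exp_neg_mul_sq one_pos
      · simpa [hi] using integrable_exp_neg_mul_sq one_pos
  refine h.congr (Eventually.of_forall fun w => ?_)
  simp only [Finset.prod_mul_distrib, ← Real.exp_sum]
  simp

open scoped MatrixOrder in
/-- A positive definite quadratic form of determinant one is, up to a linear change of variables
preserving Lebesgue measure, a sum of squares. -/
lemma exists_measurePreserving_sum_sq {G : Matrix ι ι ℝ} (hG : G.PosDef) (hdet : G.det = 1) :
    ∃ B : Matrix ι ι ℝ, IsUnit B.det ∧ MeasurePreserving (fun u => B.mulVec u) volume volume ∧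
      ∀ u : ι → ℝ, u ⬝ᵥ G.mulVec u = ∑ i, B.mulVec u i ^ 2 := by
  obtain ⟨B, hB⟩ :=
    CStarAlgebra.nonneg_iff_eq_star_mul_self.mp hG.posSemidef.nonneg
  rw [Matrix.star_eq_conjTranspose, Matrix.conjTranspose_eq_transpose_of_trivial] at hB
  have hB2 : B.det * B.det = 1 := by
    rw [← hdet, hB, Matrix.det_mul, Matrix.det_transpose]
  have hB0 : B.det ≠ 0 := fun h => by simp [h] at hB2
  have habs : |B.det| = 1 := by
    rw [← abs_mul_abs_self] at hB2
    nlinarith [abs_nonneg B.det]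
  refine ⟨B, hB0.isUnit, ⟨by fun_prop, ?_⟩, fun u => ?_⟩
  · have := Real.map_matrix_volume_pi_eq_smul_volume_pi hB0
    rw [abs_inv, habs, inv_one, ENNReal.ofReal_one, one_smul] at this
    exact this
  · rw [hB, ← Matrix.mulVec_mulVec, Matrix.dotProduct_mulVec, Matrix.vecMul_transpose]
    simp [dotProduct, sq]

variable {G : Matrix ι ι ℝ}

lemma integrable_exp_neg_quadratic (hG : G.PosDef) (hdet : G.det = 1) :
    Integrable (fun u : ι → ℝ => Real.exp (-(u ⬝ᵥ G.mulVec u))) := by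
  obtain ⟨B, -, hB, h⟩ := exists_measurePreserving_sum_sq hG hdet
  simp_rw [h]
  exact hB.integrable_comp_of_integrable integrable_exp_neg_sum_sq

lemma integral_exp_neg_quadratic (hG : G.PosDef) (hdet : G.det = 1) :
    ∫ u : ι → ℝ, Real.exp (-(u ⬝ᵥ G.mulVec u)) = √Real.pi ^ Fintype.card ι := by
  obtain ⟨B, -, hB, h⟩ := exists_measurePreserving_sum_sq hG hdet
  simp_rw [h]
  rw [← integral_exp_neg_sum_sq]
  conv_rhs => rw [← hB.map_eq]
  rw [integral_map hB.aemeasurable]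
  exact (by fun_prop : Continuous _).aestronglyMeasurable

lemma integrable_coord_mul_exp_neg_quadratic (hG : G.PosDef) (hdet : G.det = 1) (k : ι) :
    Integrable (fun u : ι → ℝ => u k * Real.exp (-(u ⬝ᵥ G.mulVec u))) := by
  obtain ⟨B, hu, hB, h⟩ := exists_measurePreserving_sum_sq hG hdet
  have hk (u : ι → ℝ) : u k = ∑ i, B⁻¹ k i * B.mulVec u i := by
    change _ = B⁻¹.mulVec (B.mulVec u) k
    rw [Matrix.mulVec_mulVec, Matrix.nonsing_inv_mul _ hu, Matrix.one_mulVec]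
  simp_rw [h]
  have hinteg : Integrable (fun w : ι → ℝ =>
      ∑ i, B⁻¹ k i * (w i * Real.exp (-∑ i, w i ^ 2))) :=
    integrable_finsetSum _ fun i _ => (integrable_coord_mul_exp_neg_sum_sq i).const_mul _
  refine (hB.integrable_comp_of_integrable hinteg).congr (Eventually.of_forall fun u => ?_)
  simp only [Function.comp_def, ← mul_assoc, ← Finset.sum_mul, ← hk u]

end Gaussian

section Symplectic

lemma exists_matrix_stdSymp (n : ℕ) : ∃ Ω : Matrix (Fin (2*n)) (Fin (2*n)) ℝ,
    Ω.det * Ω.det = 1 ∧ ∀ u v, stdSymp n u v = u ⬝ᵥ Ω.mulVec v := by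
  let e : Fin n ⊕ Fin n ≃ Fin (2*n) := finSumFinEquiv.trans (finCongr (two_mul n).symm)
  refine ⟨(-Matrix.J (Fin n) ℝ).submatrix e.symm e.symm, ?_, fun u v => ?_⟩
  · rw [Matrix.det_submatrix_equiv_self, ← Matrix.det_mul, neg_mul_neg, Matrix.det_mul,
      Matrix.J_det_mul_J_det]
  · rw [Matrix.submatrix_mulVec_equiv, dotProduct_comp_equiv_symm]
    have hu : u ∘ e = Sum.elim (fun k : Fin n => u ⟨k.1, by omega⟩)
        fun k : Fin n => u ⟨n + k.1, by omega⟩ := by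
      ext (i | i) <;> rfl
    have hv : v ∘ e.symm.symm = Sum.elim (fun k : Fin n => v ⟨k.1, by omega⟩)
        fun k : Fin n => v ⟨n + k.1, by omega⟩ := by
      ext (i | i) <;> rfl
    rw [hu, hv]
    simp [stdSymp, Matrix.J, Matrix.fromBlocks_neg, Matrix.fromBlocks_mulVec, dotProduct,
      Matrix.neg_mulVec, sub_eq_add_neg, Finset.sum_add_distrib]

variable {n : ℕ} {J : (Fin (2*n) → ℝ) →ₗ[ℝ] (Fin (2*n) → ℝ)}
  {g : (Fin (2*n) → ℝ) → (Fin (2*n) → ℝ) → ℝ}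

/-- The Gram matrix of the inner product induced by a compatible complex structure represents this
inner product, is positive definite and has determinant one. -/
lemma compatible_gram (hJ : ∀ u, J (J u) = -u) (hg : ∀ u v, g u v = stdSymp n u (J v))
    (hgsymm : ∀ u v, g u v = g v u) (hgpos : ∀ u, u ≠ 0 → 0 < g u u)
    {G : Matrix (Fin (2*n)) (Fin (2*n)) ℝ}
    (hG : G = Matrix.of fun i j => g (basisVec n i) (basisVec n j)) :
    (∀ u v, g u v = u ⬝ᵥ G.mulVec v) ∧ G.PosDef ∧ G.det = 1 := by
  obtain ⟨Ω, hΩ, hθ⟩ := exists_matrix_stdSymp n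
  have hrep (u v) : g u v = u ⬝ᵥ (Ω * J.toMatrix').mulVec v := by
    rw [hg, hθ, ← Matrix.mulVec_mulVec, LinearMap.toMatrix'_mulVec]
  have hGeq : G = Ω * J.toMatrix' := by
    ext i j
    simp [hG, hrep, basisVec]
  have hpos : G.PosDef := by
    refine .of_dotProduct_mulVec_pos ?_ fun x hx => ?_
    · ext i j
      simpa [hG] using hgsymm _ _
    · simpa [hGeq, hrep] using hgpos x hx
  have hJdet : LinearMap.det J * LinearMap.det J = 1 := by
    have : J ∘ₗ J = (-1 : ℝ) • LinearMap.id := by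
      refine LinearMap.ext fun u => ?_
      simp [hJ u]
    rw [← LinearMap.det_comp, this, LinearMap.det_smul]
    simp
  refine ⟨fun u v => hGeq ▸ hrep u v, hpos, ?_⟩
  have h1 : G.det * G.det = 1 := by
    rw [hGeq, Matrix.det_mul, LinearMap.det_toMatrix']
    linear_combination LinearMap.det J * LinearMap.det J * hΩ + hJdet
  nlinarith [hpos.det_pos]

end Symplectic

section Action

variable {n : ℕ} {A : Type*} [NonUnitalCStarAlgebra A] {α : (Fin (2*n) → ℝ) → (A ≃⋆ₐ[ℂ] A)}

/-- A *-automorphism as a continuous real-linear map. -/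
noncomputable def starAutCLM (f : A ≃⋆ₐ[ℂ] A) : A →L[ℝ] A :=
  (AddMonoidHomClass.toAddMonoidHom f).toRealLinearMap (StarAlgEquiv.isometry f).continuous

@[simp]
lemma starAutCLM_apply (f : A ≃⋆ₐ[ℂ] A) (a : A) : starAutCLM f a = f a := rfl

lemma hasDerivAt_act_zero {a : A} (ha : ContDiff ℝ (⊤ : ℕ∞) fun u => α u a) (k : Fin (2*n)) :
    HasDerivAt (fun t : ℝ => α (t • basisVec n k) a) (actDeriv α k a) 0 := by
  have hd : Differentiable ℝ fun u => α u a := ha.differentiable (by simp)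
  have : DifferentiableAt ℝ (fun t : ℝ => α (t • basisVec n k) a) 0 :=
    (hd _).comp (0 : ℝ) (by fun_prop : DifferentiableAt ℝ (fun t : ℝ => t • basisVec n k) 0)
  exact this.hasDerivAt

lemma fderiv_act_basisVec (hhom : ∀ u v : Fin (2*n) → ℝ, ∀ a : A, α (u + v) a = α u (α v a))
    {a : A} (ha : ContDiff ℝ (⊤ : ℕ∞) fun u => α u a) (u : Fin (2*n) → ℝ) (k : Fin (2*n)) :
    fderiv ℝ (fun u => α u a) u (basisVec n k) = α u (actDeriv α k a) := by
  have hd : Differentiable ℝ fun u => α u a := ha.differentiable (by simp)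
  have h1 := (hd u).hasFDerivAt.hasLineDerivAt (basisVec n k)
  have h2 : HasLineDerivAt ℝ (fun u => α u a) (α u (actDeriv α k a)) u (basisVec n k) := by
    have := (starAutCLM (α u)).hasFDerivAt.comp_hasDerivAt (0 : ℝ) (hasDerivAt_act_zero ha k)
    simpa [HasLineDerivAt, hhom, Function.comp_def] using this
  rw [← h1.lineDeriv, h2.lineDeriv]

lemma contDiff_act_actDeriv
    (hhom : ∀ u v : Fin (2*n) → ℝ, ∀ a : A, α (u + v) a = α u (α v a))
    {a : A} (ha : ContDiff ℝ (⊤ : ℕ∞) fun u => α u a) (k : Fin (2*n)) :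
    ContDiff ℝ (⊤ : ℕ∞) fun u => α u (actDeriv α k a) := by
  simp_rw [← fderiv_act_basisVec hhom ha]
  exact (ha.fderiv_right (m := (⊤ : ℕ∞)) (by simp)).clm_apply contDiff_const

lemma act_actLaplacian (g : (Fin (2*n) → ℝ) → (Fin (2*n) → ℝ) → ℝ) (f : A ≃⋆ₐ[ℂ] A) (a : A) :
    f (actLaplacian α g a) = ∑ k, ∑ l,
      ((Matrix.of fun i j => g (basisVec n i) (basisVec n j))⁻¹ k l) •
        f (actDeriv α k (actDeriv α l a)) := by
  simp only [actLaplacian, ← starAutCLM_apply, map_sum, map_smul]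

lemma contDiff_act_actLaplacian
    (hhom : ∀ u v : Fin (2*n) → ℝ, ∀ a : A, α (u + v) a = α u (α v a))
    (g : (Fin (2*n) → ℝ) → (Fin (2*n) → ℝ) → ℝ)
    {a : A} (ha : ContDiff ℝ (⊤ : ℕ∞) fun u => α u a) :
    ContDiff ℝ (⊤ : ℕ∞) fun u => α u (actLaplacian α g a) := by
  simp_rw [act_actLaplacian]
  exact ContDiff.sum fun k _ => ContDiff.sum fun l _ => contDiff_const.smul
    (contDiff_act_actDeriv hhom (contDiff_act_actDeriv hhom ha l) k)

lemma hasDerivAt_act_smul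
    (hhom : ∀ u v : Fin (2*n) → ℝ, ∀ a : A, α (u + v) a = α u (α v a))
    {a : A} (ha : ContDiff ℝ (⊤ : ℕ∞) fun u => α u a) (u : Fin (2*n) → ℝ) (r : ℝ) :
    HasDerivAt (fun r : ℝ => α (r • u) a) (∑ l, u l • α (r • u) (actDeriv α l a)) r := by
  have hd : Differentiable ℝ fun u => α u a := ha.differentiable (by simp)
  have h1 := (hd (r • u)).hasFDerivAt.comp_hasDerivAt r ((hasDerivAt_id r).smul_const u)
  refine h1.congr_deriv ?_
  have hu : u = ∑ l, u l • basisVec n l := by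
    simpa [basisVec] using pi_eq_sum_univ' u
  rw [one_smul]
  conv_lhs => rw [hu, map_sum]
  simp only [map_smul, ← hu, fderiv_act_basisVec hhom ha]

lemma act_zero (hhom : ∀ u v : Fin (2*n) → ℝ, ∀ a : A, α (u + v) a = α u (α v a)) (a : A) :
    α 0 a = a :=
  EquivLike.injective (α 0) (by rw [← hhom, add_zero])

lemma integrable_smul_act (hcont : ∀ a : A, Continuous fun u => α u a)
    {ψ : (Fin (2*n) → ℝ) → ℝ} (hψ : Integrable ψ) (r : ℝ) (a : A) :
    Integrable fun u => ψ u • α (r • u) a := by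
  have hc : Continuous fun u : Fin (2*n) → ℝ => α (r • u) a :=
    (hcont a).comp (continuous_const_smul r)
  refine (hψ.norm.mul_const ‖a‖).mono' (hψ.aestronglyMeasurable.smul hc.aestronglyMeasurable)
    (Eventually.of_forall fun u => ?_)
  rw [norm_smul, StarAlgEquiv.norm_map]

end Action

section GaussianAverage

variable {n : ℕ} {A : Type*} [NonUnitalCStarAlgebra A] {α : (Fin (2*n) → ℝ) → (A ≃⋆ₐ[ℂ] A)}
  {G : Matrix (Fin (2*n)) (Fin (2*n)) ℝ}

lemma hasLineDerivAt_exp_neg_quadratic (hG : G.PosDef) (u : Fin (2*n) → ℝ) (k : Fin (2*n)) :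
    HasLineDerivAt ℝ (fun u => Real.exp (-(u ⬝ᵥ G.mulVec u)))
      (-2 * (G.mulVec u k * Real.exp (-(u ⬝ᵥ G.mulVec u)))) u (basisVec n k) := by
  have hsymm : u ⬝ᵥ G.mulVec (basisVec n k) = G.mulVec u k := by
    have hT : G.transpose = G := hG.isHermitian
    rw [Matrix.dotProduct_mulVec, ← Matrix.mulVec_transpose, hT]
    simp [basisVec]
  have hexp (t : ℝ) : (u + t • basisVec n k) ⬝ᵥ G.mulVec (u + t • basisVec n k) =
      u ⬝ᵥ G.mulVec u + t * (2 * G.mulVec u k) + t ^ 2 * G k k := by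
    have h1 : basisVec n k ⬝ᵥ G.mulVec u = G.mulVec u k := by simp [basisVec]
    have h2 : basisVec n k ⬝ᵥ G.mulVec (basisVec n k) = G k k := by simp [basisVec]
    simp only [Matrix.mulVec_add, Matrix.mulVec_smul, dotProduct_add, add_dotProduct,
      dotProduct_smul, smul_dotProduct, hsymm, h1, h2, smul_eq_mul]
    ring
  simp only [HasLineDerivAt, hexp]
  have h := (((((hasDerivAt_id (0 : ℝ)).mul_const (2 * G.mulVec u k)).const_add
    (u ⬝ᵥ G.mulVec u)).add (((hasDerivAt_id (0 : ℝ)).pow 2).mul_const (G k k))).neg).exp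
  refine h.congr_deriv ?_
  simp
  ring

lemma integrable_mulVec_mul_exp_neg_quadratic (hG : G.PosDef) (hdet : G.det = 1)
    (k : Fin (2*n)) :
    Integrable fun u : Fin (2*n) → ℝ => G.mulVec u k * Real.exp (-(u ⬝ᵥ G.mulVec u)) := by
  have : Integrable fun u : Fin (2*n) → ℝ =>
      ∑ l, G k l * (u l * Real.exp (-(u ⬝ᵥ G.mulVec u))) :=
    integrable_finsetSum _ fun l _ =>
      (integrable_coord_mul_exp_neg_quadratic hG hdet l).const_mul _
  refine this.congr (Eventually.of_forall fun u => ?_)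
  simp only [← mul_assoc, ← Finset.sum_mul]
  rfl

/-- Integration by parts against a Gaussian. -/
lemma integral_mulVec_mul_exp_smul_act
    (hhom : ∀ u v : Fin (2*n) → ℝ, ∀ a : A, α (u + v) a = α u (α v a))
    (hcont : ∀ a : A, Continuous fun u => α u a) (hG : G.PosDef) (hdet : G.det = 1)
    {a : A} (ha : ContDiff ℝ (⊤ : ℕ∞) fun u => α u a) (r : ℝ) (k : Fin (2*n)) :
    ∫ u : Fin (2*n) → ℝ, (G.mulVec u k * Real.exp (-(u ⬝ᵥ G.mulVec u))) • α (r • u) a =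
      (r / 2) • ∫ u : Fin (2*n) → ℝ,
        Real.exp (-(u ⬝ᵥ G.mulVec u)) • α (r • u) (actDeriv α k a) := by
  have hw := integrable_exp_neg_quadratic hG hdet
  have hGw := integrable_mulVec_mul_exp_neg_quadratic hG hdet k
  have hline (u : Fin (2*n) → ℝ) : HasLineDerivAt ℝ (fun u => α (r • u) a)
      (r • α (r • u) (actDeriv α k a)) u (basisVec n k) := by
    have h0 : HasDerivAt (fun t : ℝ => α ((r * t) • basisVec n k) a)
        (r • actDeriv α k a) 0 := by
      have hz := hasDerivAt_act_zero ha k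
      rw [← mul_zero r] at hz
      exact (hz.scomp (0 : ℝ) ((hasDerivAt_id' (0 : ℝ)).const_mul r)).congr_deriv (by simp)
    have := (starAutCLM (α (r • u))).hasFDerivAt.comp_hasDerivAt (0 : ℝ) h0
    simpa only [HasLineDerivAt, Function.comp_def, map_smul, starAutCLM_apply, smul_add, hhom,
      smul_smul] using this
  have key := integral_bilinear_hasLineDerivAt_right_eq_neg_left_of_integrable
    (μ := (volume : Measure (Fin (2*n) → ℝ))) (B := ContinuousLinearMap.lsmul ℝ ℝ)
    (v := basisVec n k)
    (f := fun u => Real.exp (-(u ⬝ᵥ G.mulVec u)))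
    (f' := fun u => -2 * (G.mulVec u k * Real.exp (-(u ⬝ᵥ G.mulVec u))))
    (g := fun u => α (r • u) a) (g' := fun u => r • α (r • u) (actDeriv α k a))
    (integrable_smul_act hcont (hGw.const_mul (-2)) r a)
    (((integrable_smul_act hcont hw r (actDeriv α k a)).smul r).congr
      (Eventually.of_forall fun u => smul_comm r _ _))
    (integrable_smul_act hcont hw r a)
    (fun u _ => hasLineDerivAt_exp_neg_quadratic hG u k) (fun u _ => hline u)
  simp only [ContinuousLinearMap.lsmul_apply, smul_comm _ r, mul_smul (-2 : ℝ)] at key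
  rw [integral_smul, integral_smul, neg_smul, neg_neg] at key
  rw [div_eq_inv_mul, mul_smul, key, smul_smul]
  norm_num

/-- The Gaussian average satisfies the heat equation in the square root of the time variable. -/
lemma hasDerivAt_integral_exp_smul_act
    (hhom : ∀ u v : Fin (2*n) → ℝ, ∀ a : A, α (u + v) a = α u (α v a))
    (hcont : ∀ a : A, Continuous fun u => α u a)
    {g : (Fin (2*n) → ℝ) → (Fin (2*n) → ℝ) → ℝ}
    (hGg : G = Matrix.of fun i j => g (basisVec n i) (basisVec n j))
    (hG : G.PosDef) (hdet : G.det = 1)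
    {a : A} (ha : ContDiff ℝ (⊤ : ℕ∞) fun u => α u a) (r : ℝ) :
    HasDerivAt (fun r : ℝ => ∫ u : Fin (2*n) → ℝ, Real.exp (-(u ⬝ᵥ G.mulVec u)) • α (r • u) a)
      ((r / 2) • ∫ u : Fin (2*n) → ℝ,
        Real.exp (-(u ⬝ᵥ G.mulVec u)) • α (r • u) (actLaplacian α g a)) r := by
  have hw := integrable_exp_neg_quadratic hG hdet
  have hcw := integrable_coord_mul_exp_neg_quadratic hG hdet
  have hGw := integrable_mulVec_mul_exp_neg_quadratic hG hdet
  have hF'int : Integrable fun u : Fin (2*n) → ℝ =>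
      ∑ l, (u l * Real.exp (-(u ⬝ᵥ G.mulVec u))) • α (r • u) (actDeriv α l a) :=
    integrable_finsetSum _ fun l _ => integrable_smul_act hcont (hcw l) r _
  have hder := (hasDerivAt_integral_of_dominated_loc_of_deriv_le (𝕜 := ℝ)
    (μ := (volume : Measure (Fin (2*n) → ℝ)))
    (F := fun r u => Real.exp (-(u ⬝ᵥ G.mulVec u)) • α (r • u) a)
    (F' := fun r u => ∑ l, (u l * Real.exp (-(u ⬝ᵥ G.mulVec u))) • α (r • u) (actDeriv α l a))
    (bound := fun u => ∑ l, ‖u l * Real.exp (-(u ⬝ᵥ G.mulVec u))‖ * ‖actDeriv α l a‖)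
    (x₀ := r) (s := Set.univ) Filter.univ_mem
    (Eventually.of_forall fun r => (integrable_smul_act hcont hw r a).aestronglyMeasurable)
    (integrable_smul_act hcont hw r a) hF'int.aestronglyMeasurable
    (Eventually.of_forall fun u r _ => (norm_sum_le _ _).trans_eq <|
      Finset.sum_congr rfl fun l _ => by rw [norm_smul, StarAlgEquiv.norm_map])
    (integrable_finsetSum _ fun l _ => (hcw l).norm.mul_const _)
    (Eventually.of_forall fun u r _ => by
      refine ((hasDerivAt_act_smul hhom ha u r).const_smul
        (Real.exp (-(u ⬝ᵥ G.mulVec u)))).congr_deriv ?_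
      simp only [Finset.smul_sum, smul_smul, mul_comm])).2
  refine hder.congr_deriv ?_
  have hu (u : Fin (2*n) → ℝ) (l : Fin (2*n)) : u l = ∑ k, G⁻¹ k l * G.mulVec u k := by
    have hT : G.transpose = G := hG.isHermitian
    have : Matrix.vecMul (G.mulVec u) G⁻¹ = u := by
      rw [← hT, Matrix.mulVec_transpose, hT, Matrix.vecMul_vecMul,
        Matrix.mul_nonsing_inv _ (by simp [hdet]), Matrix.vecMul_one]
    conv_lhs => rw [← this]
    simp [Matrix.vecMul, dotProduct, mul_comm]
  have hterm (l : Fin (2*n)) :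
      ∫ u : Fin (2*n) → ℝ, (u l * Real.exp (-(u ⬝ᵥ G.mulVec u))) • α (r • u) (actDeriv α l a) =
        ∑ k, G⁻¹ k l • (r / 2) • ∫ u : Fin (2*n) → ℝ,
          Real.exp (-(u ⬝ᵥ G.mulVec u)) • α (r • u) (actDeriv α k (actDeriv α l a)) := by
    have hsum := integral_finsetSum Finset.univ fun k _ =>
      (integrable_smul_act hcont (hGw k) r (actDeriv α l a)).smul (G⁻¹ k l)
    simp only [Pi.smul_apply, integral_smul, integral_mulVec_mul_exp_smul_act hhom hcont hG hdet
      (contDiff_act_actDeriv hhom ha l) r] at hsum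
    rw [← hsum]
    refine integral_congr_ae (Eventually.of_forall fun u => ?_)
    dsimp only
    conv_lhs => rw [hu u l]
    simp only [Finset.sum_mul, Finset.sum_smul, smul_smul, mul_assoc]
  have hlap (u : Fin (2*n) → ℝ) :
      Real.exp (-(u ⬝ᵥ G.mulVec u)) • α (r • u) (actLaplacian α g a) =
        ∑ k, ∑ l, G⁻¹ k l •
          Real.exp (-(u ⬝ᵥ G.mulVec u)) • α (r • u) (actDeriv α k (actDeriv α l a)) := by
    simp only [act_actLaplacian, ← hGg, Finset.smul_sum, smul_comm (Real.exp _)]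
  rw [integral_finsetSum _ fun l _ => integrable_smul_act hcont (hcw l) r _]
  simp_rw [hterm, hlap]
  have hinteg (k l : Fin (2*n)) :=
    (integrable_smul_act hcont hw r (actDeriv α k (actDeriv α l a))).smul (G⁻¹ k l)
  have hsum := integral_finsetSum Finset.univ fun k _ =>
    integrable_finsetSum Finset.univ fun l _ => hinteg k l
  have hsum' (k : Fin (2*n)) := integral_finsetSum Finset.univ fun l _ => hinteg k l
  simp only [Pi.smul_apply, integral_smul] at hsum hsum'
  rw [hsum, Finset.sum_comm, Finset.smul_sum]
  refine Finset.sum_congr rfl fun k _ => ?_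
  rw [hsum' k, Finset.smul_sum]
  exact Finset.sum_congr rfl fun l _ => smul_comm _ _ _

end GaussianAverage

section Expansion

variable {n : ℕ} {A : Type*} [NonUnitalCStarAlgebra A] {α : (Fin (2*n) → ℝ) → (A ≃⋆ₐ[ℂ] A)}
  {G : Matrix (Fin (2*n)) (Fin (2*n)) ℝ}

/-- Taylor expansion, with remainder, of the Gaussian average in the heat semigroup parameter. -/
lemma exists_norm_integral_exp_smul_act_sub_le
    (hhom : ∀ u v : Fin (2*n) → ℝ, ∀ a : A, α (u + v) a = α u (α v a))
    (hcont : ∀ a : A, Continuous fun u => α u a)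
    {g : (Fin (2*n) → ℝ) → (Fin (2*n) → ℝ) → ℝ}
    (hGg : G = Matrix.of fun i j => g (basisVec n i) (basisVec n j))
    (hG : G.PosDef) (hdet : G.det = 1)
    {a : A} (ha : ContDiff ℝ (⊤ : ℕ∞) fun u => α u a) (N : ℕ) :
    ∃ C : ℝ, 0 ≤ C ∧ ∀ r : ℝ, 0 ≤ r →
      ‖(∫ u : Fin (2*n) → ℝ, Real.exp (-(u ⬝ᵥ G.mulVec u)) • α (r • u) a) -
          ∑ j ∈ Finset.range N, ((∫ u : Fin (2*n) → ℝ, Real.exp (-(u ⬝ᵥ G.mulVec u))) *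
            ((r ^ 2 / 4) ^ j / (j.factorial : ℝ))) • (actLaplacian α g)^[j] a‖ ≤
        C * r ^ (2 * N) := by
  have hw := integrable_exp_neg_quadratic hG hdet
  set c : ℝ := ∫ u : Fin (2*n) → ℝ, Real.exp (-(u ⬝ᵥ G.mulVec u)) with hc
  induction N generalizing a with
  | zero =>
    refine ⟨c * ‖a‖, mul_nonneg (integral_nonneg fun u => (Real.exp_pos _).le) (norm_nonneg _),
      fun r _ => ?_⟩
    have := norm_integral_le_of_norm_le (hw.mul_const ‖a‖) (Eventually.of_forall fun u =>
      (by rw [norm_smul, StarAlgEquiv.norm_map, Real.norm_of_nonneg (Real.exp_pos _).le] :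
        ‖Real.exp (-(u ⬝ᵥ G.mulVec u)) • α (r • u) a‖ ≤ _))
    simpa [integral_mul_const] using this
  | succ N ih =>
    obtain ⟨C, hC, hbound⟩ := ih (contDiff_act_actLaplacian hhom g ha)
    refine ⟨C, hC, fun r hr => ?_⟩
    let R : ℝ → A := fun r =>
      (∫ u : Fin (2*n) → ℝ, Real.exp (-(u ⬝ᵥ G.mulVec u)) • α (r • u) a) -
        ∑ j ∈ Finset.range (N + 1), (c * ((r ^ 2 / 4) ^ j / (j.factorial : ℝ))) •
          (actLaplacian α g)^[j] a
    have hR0 : R 0 = 0 := by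
      simp only [R, zero_smul, act_zero hhom, integral_smul_const, ← hc]
      rw [Finset.sum_eq_single 0 (fun j _ hj => by simp [hj]) (by simp)]
      simp
    have hcoef (j : ℕ) (s : ℝ) : HasDerivAt
        (fun r : ℝ => c * ((r ^ 2 / 4) ^ (j + 1) / ((j + 1).factorial : ℝ)))
        ((s / 2) * (c * ((s ^ 2 / 4) ^ j / (j.factorial : ℝ)))) s := by
      have h := ((((hasDerivAt_pow 2 s).div_const 4).pow (j + 1)).div_const
        ((j + 1).factorial : ℝ)).const_mul c
      refine h.congr_deriv ?_
      have : (j.factorial : ℝ) ≠ 0 := by positivity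
      push_cast [Nat.factorial_succ]
      field_simp
      ring_nf
    have hR' (s : ℝ) : HasDerivAt R ((s / 2) •
        ((∫ u : Fin (2*n) → ℝ,
            Real.exp (-(u ⬝ᵥ G.mulVec u)) • α (s • u) (actLaplacian α g a)) -
          ∑ j ∈ Finset.range N, (c * ((s ^ 2 / 4) ^ j / (j.factorial : ℝ))) •
            (actLaplacian α g)^[j] (actLaplacian α g a))) s := by
      have hsum : HasDerivAt (fun r : ℝ => ∑ j ∈ Finset.range (N + 1),
          (c * ((r ^ 2 / 4) ^ j / (j.factorial : ℝ))) • (actLaplacian α g)^[j] a)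
          (∑ j ∈ Finset.range N, ((s / 2) * (c * ((s ^ 2 / 4) ^ j / (j.factorial : ℝ)))) •
            (actLaplacian α g)^[j] (actLaplacian α g a)) s := by
        simp only [Finset.sum_range_succ', pow_zero, Function.iterate_succ_apply]
        exact (HasDerivAt.fun_sum fun j _ => (hcoef j s).smul_const _).add_const _
      refine ((hasDerivAt_integral_exp_smul_act hhom hcont hGg hG hdet ha s).sub
        hsum).congr_deriv ?_
      simp only [smul_sub, Finset.smul_sum, smul_smul]
    have hmv := norm_image_sub_le_of_norm_deriv_le_segment' (a := 0) (b := r)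
      (C := r * (C * r ^ (2 * N))) (fun s _ => (hR' s).hasDerivWithinAt) (fun s hs => by
        have hs0 : 0 ≤ s := hs.1
        have hsr : s ≤ r := hs.2.le
        rw [norm_smul, Real.norm_of_nonneg (by positivity)]
        refine mul_le_mul (by linarith) ((hbound s hs0).trans (by gcongr)) (norm_nonneg _) hr)
      r (Set.right_mem_Icc.2 hr)
    rw [hR0, sub_zero, sub_zero] at hmv
    exact hmv.trans_eq (by ring)

end Expansion

theorem smoothingOp_asymptotic_expansion {n : ℕ} {A : Type*} [NonUnitalCStarAlgebra A]
    -- `α` is an action of `(ℝ^{2n}, +)` by *-automorphisms ...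
    (α : (Fin (2*n) → ℝ) → (A ≃⋆ₐ[ℂ] A))
    (hhom : ∀ u v : Fin (2*n) → ℝ, ∀ a : A, α (u + v) a = α u (α v a))
    -- ... which is strongly continuous:
    (hcont : ∀ a : A, Continuous fun u => α u a)
    -- `J` is a linear complex structure on `ℝ^{2n}` ...
    (J : (Fin (2*n) → ℝ) →ₗ[ℝ] (Fin (2*n) → ℝ))
    (hJ : ∀ u, J (J u) = -u)
    -- ... compatible with the standard symplectic form `θ`, i.e. `g(u,v) = θ(u, Jv)` is a
    -- symmetric positive-definite inner product:
    (g : (Fin (2*n) → ℝ) → (Fin (2*n) → ℝ) → ℝ)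
    (hg : ∀ u v, g u v = stdSymp n u (J v))
    (hgsymm : ∀ u v, g u v = g v u)
    (hgpos : ∀ u, u ≠ 0 → 0 < g u u) :
    -- asymptotic expansion `S_ℏ(a) ∼ e^{(ℏ/4) Δ_g} a` as `ℏ → 0⁺`:
    ∀ a : A, ContDiff ℝ (⊤ : ℕ∞) (fun u : Fin (2*n) → ℝ => α u a) →
      ∀ N : ℕ, ∃ C : ℝ, 0 ≤ C ∧ ∀ ℏ ∈ Set.Ioc (0 : ℝ) 1,
        ‖smoothingOp α g ℏ a -
            ∑ j ∈ Finset.range N, ((ℏ / 4) ^ j / (j.factorial : ℝ)) •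
              (actLaplacian α g)^[j] a‖ ≤ C * ℏ ^ N := by
  intro a ha N
  set G : Matrix (Fin (2*n)) (Fin (2*n)) ℝ :=
    Matrix.of fun i j => g (basisVec n i) (basisVec n j) with hGg
  obtain ⟨hrep, hG, hdet⟩ := compatible_gram hJ hg hgsymm hgpos hGg
  obtain ⟨C, hC, hbound⟩ := exists_norm_integral_exp_smul_act_sub_le hhom hcont hGg hG hdet ha N
  have hpi : (0 : ℝ) < Real.pi ^ n := by positivity
  have hI : ∫ u : Fin (2*n) → ℝ, Real.exp (-(u ⬝ᵥ G.mulVec u)) = Real.pi ^ n := by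
    rw [integral_exp_neg_quadratic hG hdet, Fintype.card_fin, pow_mul, Real.sq_sqrt Real.pi_pos.le]
  refine ⟨(Real.pi ^ n)⁻¹ * C, by positivity, fun ℏ hℏ => ?_⟩
  have hℏ0 : 0 < ℏ := hℏ.1
  have hsq : √ℏ ^ 2 = ℏ := Real.sq_sqrt hℏ0.le
  have hS : smoothingOp α g ℏ a = (Real.pi ^ n)⁻¹ • ∫ u : Fin (2*n) → ℝ,
      Real.exp (-(u ⬝ᵥ G.mulVec u)) • α (√ℏ • u) a := by
    have hscale := Measure.integral_comp_smul_of_nonneg (volume : Measure (Fin (2*n) → ℝ))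
      (fun u => Real.exp (-(g u u) / ℏ) • α u a) (√ℏ) (hR := Real.sqrt_nonneg ℏ)
    have hexp (u : Fin (2*n) → ℝ) :
        -(g (√ℏ • u) (√ℏ • u)) / ℏ = -(u ⬝ᵥ G.mulVec u) := by
      rw [hrep, Matrix.mulVec_smul, dotProduct_smul, smul_dotProduct, smul_smul, ← sq, hsq,
        smul_eq_mul]
      field_simp
    simp only [hexp, Module.finrank_fin_fun, pow_mul, hsq] at hscale
    rw [hscale, smoothingOp, smul_smul, mul_pow, mul_inv]
  have hmain := hbound √ℏ (Real.sqrt_nonneg ℏ)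
  rw [hI, pow_mul, hsq] at hmain
  have hsum : ∑ j ∈ Finset.range N, ((ℏ / 4) ^ j / (j.factorial : ℝ)) • (actLaplacian α g)^[j] a =
      (Real.pi ^ n)⁻¹ • ∑ j ∈ Finset.range N,
        (Real.pi ^ n * ((ℏ / 4) ^ j / (j.factorial : ℝ))) • (actLaplacian α g)^[j] a := by
    rw [Finset.smul_sum]
    exact Finset.sum_congr rfl fun j _ => by rw [smul_smul, inv_mul_cancel_left₀ hpi.ne']
  rw [hS, hsum, ← smul_sub, norm_smul, Real.norm_of_nonneg (by positivity), mul_assoc]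
  gcongr
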